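/- arXiv:2605.13692 — 2 statements merged into one kernel-verified Lean document; each statement's English description precedes it below -/
import Mathlib

section
/- Let f : 2^{[n]} → ℝ be submodular. Then the Lovász extension f_L : [0,1]^n → ℝ is a convex function, and moreover min_{x ∈ [0,1]^n} f_L(x) = min_{S ⊆ [n]} f(S). -/
open scoped BigOperators

noncomputable section

/-- Submodularity of a set function on the ground set `Fin n`. -/
def Submodular {n : ℕ} (f : Finset (Fin n) → ℝ) : Prop :=
  ∀ S T : Finset (Fin n), f (S ∪ T) + f (S ∩ T) ≤ f S + f T

/-- The chain set `C_i = {σ(0), …, σ(i-1)}` determined by a permutation `σ`. -/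
def chainOf {n : ℕ} (σ : Equiv.Perm (Fin n)) (i : ℕ) : Finset (Fin n) :=
  (Finset.univ.filter fun k : Fin n => (k : ℕ) < i).image σ

/-- The permutation sorting `x` in descending order (deterministic tie-breaking). -/
def sortPerm {n : ℕ} (x : Fin n → ℝ) : Equiv.Perm (Fin n) :=
  Tuple.sort (fun i => -x i)

/-- Sorted values `x_{π(i)}`, with the conventions `x_{π(0)} = 1` and `x_{π(n+1)} = 0`. -/
def sortedVal {n : ℕ} (x : Fin n → ℝ) (i : ℕ) : ℝ :=
  if _h0 : i = 0 then 1
  else if h : i ≤ n then x (sortPerm x ⟨i - 1, by omega⟩) else 0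

/-- The Lovász extension `f_L(x) = ∑_{i=0}^n (x_{π(i)} − x_{π(i+1)}) f(C_i)`. -/
def lovasz {n : ℕ} (f : Finset (Fin n) → ℝ) (x : Fin n → ℝ) : ℝ :=
  ∑ i ∈ Finset.range (n + 1),
    (sortedVal x i - sortedVal x (i + 1)) * f (chainOf (sortPerm x) i)

/-- Two-argument Lovász extension of a payoff `f : 2^{[n]} × Y → ℝ`. -/
def lovaszG {n m : ℕ} (f : Finset (Fin n) → (Fin m → ℝ) → ℝ)
    (x : Fin n → ℝ) (y : Fin m → ℝ) : ℝ :=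
  lovasz (fun S => f S y) x

/-- The unit cube `[0,1]^n`. -/
def cube (n : ℕ) : Set (Fin n → ℝ) := Set.Icc (0 : Fin n → ℝ) 1

theorem chainOf_zero {n : ℕ} (σ : Equiv.Perm (Fin n)) : chainOf σ 0 = ∅ := by
  simp [chainOf]

theorem chainOf_eq_univ {n : ℕ} (σ : Equiv.Perm (Fin n)) : chainOf σ n = Finset.univ := by
  simp [chainOf]

theorem mem_chainOf {n : ℕ} (σ : Equiv.Perm (Fin n)) (i : ℕ) (k : Fin n) :
    k ∈ chainOf σ i ↔ (σ.symm k : ℕ) < i := by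
  simp only [chainOf, Finset.mem_image, Finset.mem_filter, Finset.mem_univ, true_and]
  constructor
  · rintro ⟨a, ha, rfl⟩
    simpa using ha
  · intro h
    exact ⟨σ.symm k, h, by simp⟩

theorem chainOf_succ {n : ℕ} (σ : Equiv.Perm (Fin n)) (i : Fin n) :
    chainOf σ (i + 1) = insert (σ i) (chainOf σ i) := by
  ext k
  rw [Finset.mem_insert, mem_chainOf, mem_chainOf, ← Equiv.symm_apply_eq, Fin.ext_iff]
  omega

theorem apply_notMem_chainOf {n : ℕ} (σ : Equiv.Perm (Fin n)) (i : Fin n) :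
    σ i ∉ chainOf σ i := by
  simp [mem_chainOf]

/-- The marginal increments of `f` along the chain of `σ`. -/
def chainWeight {n : ℕ} (f : Finset (Fin n) → ℝ) (σ : Equiv.Perm (Fin n)) (k : Fin n) : ℝ :=
  f (chainOf σ (σ.symm k + 1)) - f (chainOf σ (σ.symm k))

theorem sum_chainWeight_chainOf {n : ℕ} (f : Finset (Fin n) → ℝ) (σ : Equiv.Perm (Fin n))
    {i : ℕ} (hi : i ≤ n) :
    f ∅ + ∑ k ∈ chainOf σ i, chainWeight f σ k = f (chainOf σ i) := by
  induction i with
  | zero => simp [chainOf_zero]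
  | succ i ih =>
    have hs := chainOf_succ σ ⟨i, hi⟩
    have hw : chainWeight f σ (σ ⟨i, hi⟩) = f (chainOf σ (i + 1)) - f (chainOf σ i) := by
      simp [chainWeight]
    have := ih (by omega)
    simp only at hs
    rw [hs, Finset.sum_insert (apply_notMem_chainOf σ ⟨i, hi⟩), ← hs, hw]
    linarith

theorem Submodular.sum_chainWeight_le {n : ℕ} {f : Finset (Fin n) → ℝ} (hf : Submodular f)
    (σ : Equiv.Perm (Fin n)) (S : Finset (Fin n)) :
    f ∅ + ∑ k ∈ S, chainWeight f σ k ≤ f S := by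
  have key : ∀ i ≤ n, f ∅ + ∑ k ∈ S ∩ chainOf σ i, chainWeight f σ k ≤ f (S ∩ chainOf σ i) := by
    intro i hi
    induction i with
    | zero => simp [chainOf_zero]
    | succ i ih =>
      have hs : chainOf σ (i + 1) = insert (σ ⟨i, hi⟩) (chainOf σ i) := chainOf_succ σ ⟨i, hi⟩
      have hn : σ ⟨i, hi⟩ ∉ chainOf σ i := apply_notMem_chainOf σ ⟨i, hi⟩
      have hw : chainWeight f σ (σ ⟨i, hi⟩) = f (chainOf σ (i + 1)) - f (chainOf σ i) := by
        simp [chainWeight]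
      have ih := ih (by omega)
      by_cases hS : σ ⟨i, hi⟩ ∈ S
      · have hsub := hf (S ∩ chainOf σ (i + 1)) (chainOf σ i)
        have hU : S ∩ chainOf σ (i + 1) ∪ chainOf σ i = chainOf σ (i + 1) := by
          rw [hs]; ext k; simp only [Finset.mem_union, Finset.mem_inter, Finset.mem_insert]; grind
        have hI : S ∩ chainOf σ (i + 1) ∩ chainOf σ i = S ∩ chainOf σ i := by
          rw [hs]; ext k; simp only [Finset.mem_inter, Finset.mem_insert]; tauto
        have hE : S ∩ chainOf σ (i + 1) = insert (σ ⟨i, hi⟩) (S ∩ chainOf σ i) := by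
          rw [hs, Finset.inter_insert_of_mem hS]
        rw [hU, hI] at hsub
        have hsum : ∑ k ∈ S ∩ chainOf σ (i + 1), chainWeight f σ k =
            chainWeight f σ (σ ⟨i, hi⟩) + ∑ k ∈ S ∩ chainOf σ i, chainWeight f σ k := by
          rw [hE, Finset.sum_insert fun h => hn (Finset.mem_inter.1 h).2]
        linarith
      · rwa [hs, Finset.inter_insert_of_notMem hS]
  simpa [chainOf_eq_univ] using key n le_rfl

theorem sum_range_sub_mul (v F : ℕ → ℝ) (j : ℕ) :
    ∑ i ∈ Finset.range (j + 1), (v i - v (i + 1)) * F i =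
      v 0 * F 0 + ∑ i ∈ Finset.range j, v (i + 1) * (F (i + 1) - F i) - v (j + 1) * F j := by
  induction j with
  | zero => simp; ring
  | succ j ih =>
    rw [Finset.sum_range_succ, ih, Finset.sum_range_succ (fun i => v (i + 1) * (F (i + 1) - F i))]
    ring

theorem sortedVal_zero {n : ℕ} (x : Fin n → ℝ) : sortedVal x 0 = 1 := by
  simp [sortedVal]

theorem sortedVal_succ {n : ℕ} (x : Fin n → ℝ) (i : Fin n) :
    sortedVal x (i + 1) = x (sortPerm x i) := by
  have : (i : ℕ) + 1 ≤ n := i.2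
  simp [sortedVal, this]

theorem sortedVal_of_lt {n : ℕ} (x : Fin n → ℝ) {i : ℕ} (hi : n < i) : sortedVal x i = 0 := by
  have h0 : i ≠ 0 := by omega
  simp [sortedVal, h0, hi]

theorem sortedVal_succ_le {n : ℕ} (x : Fin n → ℝ) {i : ℕ} (h0 : i ≠ 0) (hi : i < n) :
    sortedVal x (i + 1) ≤ sortedVal x i := by
  obtain ⟨i, rfl⟩ := Nat.exists_eq_succ_of_ne_zero h0
  have h1 := sortedVal_succ x ⟨i + 1, hi⟩
  have h2 := sortedVal_succ x ⟨i, by omega⟩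
  have h := Tuple.monotone_sort (fun i => -x i)
    (show (⟨i, by omega⟩ : Fin n) ≤ ⟨i + 1, hi⟩ from Fin.mk_le_mk.2 (by omega))
  simp only [Function.comp_apply, neg_le_neg_iff] at h
  exact h1.trans_le (h.trans_eq h2.symm)

theorem sortedVal_succ_le_of_mem_cube {n : ℕ} {x : Fin n → ℝ} (hx : x ∈ cube n) (i : ℕ) :
    sortedVal x (i + 1) ≤ sortedVal x i := by
  have hnonneg : 0 ≤ sortedVal x i := by
    unfold sortedVal
    split_ifs
    exacts [zero_le_one, hx.1 _, le_rfl]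
  rcases lt_or_ge i n with hi | hi
  · rcases eq_or_ne i 0 with rfl | h0
    · rw [sortedVal_zero, sortedVal_succ x ⟨0, hi⟩]
      exact hx.2 _
    · exact sortedVal_succ_le x h0 hi
  · rwa [sortedVal_of_lt x (by omega)]

theorem lovasz_modular {n : ℕ} (c : ℝ) (w x : Fin n → ℝ) :
    lovasz (fun S => c + ∑ k ∈ S, w k) x = c + ∑ k, x k * w k := by
  rw [lovasz, sum_range_sub_mul (sortedVal x) fun i => c + ∑ k ∈ chainOf (sortPerm x) i, w k,
    sortedVal_zero, sortedVal_of_lt x n.lt_succ_self, chainOf_zero, Finset.sum_range,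
    ← Equiv.sum_comp (sortPerm x) fun k => x k * w k]
  simp [sortedVal_succ, chainOf_succ, Finset.sum_insert, apply_notMem_chainOf]

theorem lovasz_eq_sum_chainWeight {n : ℕ} (f : Finset (Fin n) → ℝ) (x : Fin n → ℝ) :
    lovasz f x = f ∅ + ∑ k, x k * chainWeight f (sortPerm x) k := by
  rw [← lovasz_modular]
  refine Finset.sum_congr rfl fun i hi => ?_
  beta_reduce
  rw [sum_chainWeight_chainOf f _ (Finset.mem_range_succ_iff.1 hi)]

theorem lovasz_mono_of_eq {n : ℕ} {g f : Finset (Fin n) → ℝ} (h : ∀ S, g S ≤ f S)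
    (hempty : g ∅ = f ∅) (huniv : g Finset.univ = f Finset.univ) (x : Fin n → ℝ) :
    lovasz g x ≤ lovasz f x := by
  refine Finset.sum_le_sum fun i hi => ?_
  rcases eq_or_ne i 0 with rfl | h0
  · rw [chainOf_zero, hempty]
  · rcases eq_or_ne i n with rfl | hn
    · rw [chainOf_eq_univ, huniv]
    · have hi' : i < n := by have := Finset.mem_range.1 hi; omega
      exact mul_le_mul_of_nonneg_left (h _) (sub_nonneg.2 (sortedVal_succ_le x h0 hi'))

theorem lovasz_mono_of_mem_cube {n : ℕ} {g f : Finset (Fin n) → ℝ} (h : ∀ S, g S ≤ f S)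
    {x : Fin n → ℝ} (hx : x ∈ cube n) : lovasz g x ≤ lovasz f x :=
  Finset.sum_le_sum fun i _ =>
    mul_le_mul_of_nonneg_left (h _) (sub_nonneg.2 (sortedVal_succ_le_of_mem_cube hx i))

theorem Submodular.add_sum_chainWeight_le_lovasz {n : ℕ} {f : Finset (Fin n) → ℝ}
    (hf : Submodular f) (σ : Equiv.Perm (Fin n)) (x : Fin n → ℝ) :
    f ∅ + ∑ k, x k * chainWeight f σ k ≤ lovasz f x := by
  rw [← lovasz_modular]
  refine lovasz_mono_of_eq (hf.sum_chainWeight_le σ) (by simp) ?_ x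
  simpa [chainOf_eq_univ] using sum_chainWeight_chainOf f σ le_rfl

theorem Submodular.convexOn_lovasz {n : ℕ} {f : Finset (Fin n) → ℝ} (hf : Submodular f) :
    ConvexOn ℝ (cube n) (lovasz f) := by
  refine ⟨convex_Icc _ _, fun x _ y _ a b ha hb hab => ?_⟩
  rw [lovasz_eq_sum_chainWeight f (a • x + b • y)]
  set σ := sortPerm (a • x + b • y)
  calc f ∅ + ∑ k, (a • x + b • y) k * chainWeight f σ k
      = a * (f ∅ + ∑ k, x k * chainWeight f σ k) + b * (f ∅ + ∑ k, y k * chainWeight f σ k) := by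
        simp only [Pi.add_apply, Pi.smul_apply, smul_eq_mul, add_mul, Finset.sum_add_distrib,
          mul_add, Finset.mul_sum, mul_assoc]
        linear_combination (-f ∅) * hab
    _ ≤ a • lovasz f x + b • lovasz f y :=
        add_le_add (mul_le_mul_of_nonneg_left (hf.add_sum_chainWeight_le_lovasz σ x) ha)
          (mul_le_mul_of_nonneg_left (hf.add_sum_chainWeight_le_lovasz σ y) hb)

theorem Submodular.lovasz_indicator_le {n : ℕ} {f : Finset (Fin n) → ℝ} (hf : Submodular f)
    (S : Finset (Fin n)) : lovasz f (fun k => if k ∈ S then 1 else 0) ≤ f S := by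
  rw [lovasz_eq_sum_chainWeight]
  simpa using hf.sum_chainWeight_le _ S

/-- Lemma: Lovász extension — convexity and tight relaxation.
If `f : 2^{[n]} → ℝ` is submodular, then its Lovász extension is convex on `[0,1]^n`,
and the minimum of the Lovász extension over `[0,1]^n` exists and equals the minimum
of `f` over all subsets of `[n]`. -/
theorem lovasz_convex_and_tight {n : ℕ} (hn : 1 ≤ n)
    (f : Finset (Fin n) → ℝ) (hf : Submodular f) :
    ConvexOn ℝ (cube n) (lovasz f) ∧
    ∃ v : ℝ, IsLeast (lovasz f '' cube n) v ∧ IsLeast (Set.range f) v := by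
  refine ⟨hf.convexOn_lovasz, ?_⟩
  obtain ⟨S, hS⟩ := Finite.exists_min f
  have hlb : ∀ x ∈ cube n, f S ≤ lovasz f x := fun x hx => by
    have := lovasz_mono_of_mem_cube (g := fun T => f S + ∑ _k ∈ T, 0) (by simpa using hS) hx
    rw [lovasz_modular] at this
    simpa using this
  have hmem : (fun k => if k ∈ S then (1 : ℝ) else 0) ∈ cube n := by
    constructor <;> intro k <;> by_cases hk : k ∈ S <;> simp [hk]
  refine ⟨f S, ⟨⟨_, hmem, (hf.lovasz_indicator_le S).antisymm (hlb _ hmem)⟩, ?_⟩,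
    ⟨S, rfl⟩, ?_⟩
  · rintro _ ⟨x, hx, rfl⟩
    exact hlb x hx
  · rintro _ ⟨T, rfl⟩
    exact hS T

end
end

section
/- Consider an online sequence of submodular–concave games f_t on [0,1]^n × Y satisfying the boundedness assumption, and run OLMDA: projected online gradient descent on [0,1]^n with step size η_x = √n/(L_x√T) for the minimizer and projected online gradient ascent on Y with step size η_y = D_Y/(L_y√T) for the maximizer, using the Lovász subgradients g_t^x ∈ ∂_x f_L^t(x_t,y_t) and g_t^y ∈ ∂_y(−(−f_L^t))(x_t,y_t). Then the static saddle-point regret satisfies (1/T)·Reg_T ≤ (L_x√n + L_y D_Y)/√T. -/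
open scoped BigOperators

noncomputable section

/-- Euclidean inner product on `Fin k → ℝ`. -/
def dot {k : ℕ} (u v : Fin k → ℝ) : ℝ := ∑ i, u i * v i

/-- Euclidean norm on `Fin k → ℝ`. -/
def enorm2 {k : ℕ} (v : Fin k → ℝ) : ℝ := Real.sqrt (dot v v)

/-- `p` is the Euclidean projection of `target` onto `C`. -/
def IsProjOn {k : ℕ} (C : Set (Fin k → ℝ)) (target p : Fin k → ℝ) : Prop :=
  p ∈ C ∧ ∀ z ∈ C, enorm2 (fun i => p i - target i) ≤ enorm2 (fun i => z i - target i)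

/-- Expansion of the squared Euclidean norm along the line `v + s * w`. -/
lemma dot_self_add_mul {k : ℕ} (v w : Fin k → ℝ) (s : ℝ) :
    dot (fun i => v i + s * w i) (fun i => v i + s * w i)
      = dot v v + 2 * s * dot v w + s ^ 2 * dot w w := by
  simp only [dot, Finset.mul_sum, ← Finset.sum_add_distrib]
  exact Finset.sum_congr rfl fun i _ => by ring

lemma dot_self_nonneg {k : ℕ} (v : Fin k → ℝ) : 0 ≤ dot v v :=
  Finset.sum_nonneg fun i _ => mul_self_nonneg (v i)

lemma dot_self_le_sq_of_enorm2_le {k : ℕ} {v : Fin k → ℝ} {c : ℝ} (h : enorm2 v ≤ c) :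
    dot v v ≤ c ^ 2 :=
  (Real.sqrt_le_left ((Real.sqrt_nonneg _).trans h)).1 h

/-- Variational inequality for the Euclidean projection onto a convex set. -/
lemma IsProjOn.dot_nonneg {k : ℕ} {C : Set (Fin k → ℝ)} (hC : Convex ℝ C)
    {q p : Fin k → ℝ} (hp : IsProjOn C q p) {z : Fin k → ℝ} (hz : z ∈ C) :
    0 ≤ dot (fun i => p i - q i) (fun i => z i - p i) := by
  set v : Fin k → ℝ := fun i => p i - q i
  set w : Fin k → ℝ := fun i => z i - p i
  have key : ∀ s : ℝ, 0 < s → s ≤ 1 → 0 ≤ 2 * dot v w + s * dot w w := by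
    intro s hs hs1
    have hmem : (fun i => p i + s * w i) ∈ C := by
      have h := hC hp.1 hz (sub_nonneg.2 hs1) hs.le (by ring)
      convert h using 1
      ext i
      simp only [Pi.add_apply, Pi.smul_apply, smul_eq_mul, w]
      ring
    have hle := (Real.sqrt_le_sqrt_iff (dot_self_nonneg _)).1 (hp.2 _ hmem)
    have heq : (fun i => p i + s * w i - q i) = fun i => v i + s * w i := by
      ext i
      simp only [v]
      ring
    rw [heq, dot_self_add_mul] at hle
    have : 0 ≤ s * (2 * dot v w + s * dot w w) := by linarith
    exact nonneg_of_mul_nonneg_right this hs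
  by_contra! hneg
  have hw := dot_self_nonneg w
  have h := key (min 1 (-dot v w / (dot w w + 1)))
    (lt_min one_pos (div_pos (neg_pos.2 hneg) (by linarith))) (min_le_left _ _)
  have hs : min 1 (-dot v w / (dot w w + 1)) * dot w w ≤ -dot v w := by
    calc _ ≤ -dot v w / (dot w w + 1) * (dot w w + 1) :=
          mul_le_mul (min_le_right _ _) (by linarith) hw
            (div_nonneg (neg_pos.2 hneg).le (by linarith))
      _ = -dot v w := div_mul_cancel₀ _ (by linarith)
  linarith

/-- Projecting onto a convex set does not increase the distance to its points. -/
lemma IsProjOn.dot_self_sub_le {k : ℕ} {C : Set (Fin k → ℝ)} (hC : Convex ℝ C)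
    {q p : Fin k → ℝ} (hp : IsProjOn C q p) {z : Fin k → ℝ} (hz : z ∈ C) :
    dot (fun i => p i - z i) (fun i => p i - z i)
      ≤ dot (fun i => q i - z i) (fun i => q i - z i) := by
  have h := hp.dot_nonneg hC hz
  have hexp : dot (fun i => q i - z i) (fun i => q i - z i)
      = dot (fun i => p i - z i) (fun i => p i - z i)
        + 2 * dot (fun i => p i - q i) (fun i => z i - p i)
        + dot (fun i => p i - q i) (fun i => p i - q i) := by
    simp only [dot, Finset.mul_sum, ← Finset.sum_add_distrib]
    exact Finset.sum_congr rfl fun i _ => by ring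
  linarith [dot_self_nonneg fun i => p i - q i]

/-- Telescoped regret bound for projected online gradient descent with a constant step size. -/
lemma two_mul_sum_dot_le_of_isProjOn {k : ℕ} {C : Set (Fin k → ℝ)} (hC : Convex ℝ C)
    {L η : ℝ} {u g : ℕ → Fin k → ℝ} (hg : ∀ t, enorm2 (g t) ≤ L)
    (hupd : ∀ t, IsProjOn C (fun i => u t i - η * g t i) (u (t + 1)))
    {z : Fin k → ℝ} (hz : z ∈ C) (T : ℕ) :
    2 * η * ∑ t ∈ Finset.range T, dot (g t) (fun i => u t i - z i)
      ≤ dot (fun i => u 0 i - z i) (fun i => u 0 i - z i)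
        - dot (fun i => u T i - z i) (fun i => u T i - z i) + T * (η ^ 2 * L ^ 2) := by
  induction T with
  | zero => simp
  | succ T ih =>
    have hproj := (hupd T).dot_self_sub_le hC hz
    have hexp : dot (fun i => u T i - η * g T i - z i) (fun i => u T i - η * g T i - z i)
        = dot (fun i => u T i - z i) (fun i => u T i - z i)
          - 2 * η * dot (g T) (fun i => u T i - z i) + η ^ 2 * dot (g T) (g T) := by
      simp only [dot, Finset.mul_sum, ← Finset.sum_add_distrib, ← Finset.sum_sub_distrib]
      exact Finset.sum_congr rfl fun i _ => by ring
    have hgL := mul_le_mul_of_nonneg_left (dot_self_le_sq_of_enorm2_le (hg T)) (sq_nonneg η)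
    rw [Finset.sum_range_succ, mul_add]
    push_cast
    linarith

/-- Regret of projected online gradient descent with step size `D / (L * √T)`. -/
lemma sum_dot_le_of_isProjOn {k : ℕ} {C : Set (Fin k → ℝ)} (hC : Convex ℝ C)
    {L D η : ℝ} (hL : 0 < L) (hD : 0 < D) {T : ℕ} (hT : 1 ≤ T)
    (hη : η = D / (L * Real.sqrt T)) {u g : ℕ → Fin k → ℝ} (hg : ∀ t, enorm2 (g t) ≤ L)
    (hupd : ∀ t, IsProjOn C (fun i => u t i - η * g t i) (u (t + 1)))
    {z : Fin k → ℝ} (hz : z ∈ C) (hdiam : enorm2 (fun i => u 0 i - z i) ≤ D) :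
    ∑ t ∈ Finset.range T, dot (g t) (fun i => u t i - z i) ≤ L * D * Real.sqrt T := by
  have hr : 0 < Real.sqrt T := Real.sqrt_pos.2 (by exact_mod_cast hT)
  have hrr : Real.sqrt T ^ 2 = T := Real.sq_sqrt (Nat.cast_nonneg T)
  have hηpos : 0 < η := hη ▸ div_pos hD (mul_pos hL hr)
  have hηD : η * (L * Real.sqrt T) = D := by
    rw [hη]
    exact div_mul_cancel₀ _ (mul_pos hL hr).ne'
  have htel := two_mul_sum_dot_le_of_isProjOn hC hg hupd hz T
  have hsq : (T : ℝ) * (η ^ 2 * L ^ 2) = D ^ 2 := by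
    rw [← hrr, ← hηD]
    ring
  have hrhs : 2 * η * (L * D * Real.sqrt T) = D ^ 2 + D ^ 2 := by
    linear_combination 2 * D * hηD
  refine le_of_mul_le_mul_left ?_ (mul_pos two_pos hηpos)
  linarith [dot_self_le_sq_of_enorm2_le hdiam, dot_self_nonneg fun i => u T i - z i]

lemma enorm2_sub_le_sqrt_of_mem_cube {n : ℕ} {a b : Fin n → ℝ} (ha : a ∈ cube n)
    (hb : b ∈ cube n) : enorm2 (fun i => a i - b i) ≤ Real.sqrt n := by
  refine Real.sqrt_le_sqrt ?_
  have hle : ∀ i ∈ Finset.univ, (a i - b i) * (a i - b i) ≤ 1 := by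
    intro i _
    have h₁ := ha.1 i
    have h₂ := ha.2 i
    have h₃ := hb.1 i
    have h₄ := hb.2 i
    simp only [Pi.zero_apply, Pi.one_apply] at h₁ h₂ h₃ h₄
    exact abs_le_one_iff_mul_self_le_one.1 (abs_le.2 ⟨by linarith, by linarith⟩)
  simpa [dot] using Finset.sum_le_sum hle

/-- OLMDA: static saddle-point regret.
Online projected gradient descent on `[0,1]^n` with step `η_x = √n/(L_x √T)` for the
minimizer and projected gradient ascent on `Y` with step `η_y = D_Y/(L_y √T)` for the
maximizer, using Lovász subgradients, attains static saddle-point regret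
`(1/T)·Reg_T ≤ (L_x √n + L_y D_Y)/√T` against a fixed saddle point `(x⋆, y⋆)` of the
averaged game, under the boundedness assumption. -/
theorem olmda_static_regret {n m : ℕ} (hn : 1 ≤ n) (T : ℕ) (hT : 1 ≤ T)
    (Y : Set (Fin m → ℝ)) (hYcomp : IsCompact Y) (hYconv : Convex ℝ Y) (hYne : Y.Nonempty)
    (f : ℕ → Finset (Fin n) → (Fin m → ℝ) → ℝ)
    (hsub : ∀ t, ∀ y ∈ Y, Submodular (fun S => f t S y))
    (hconc : ∀ t, ∀ S : Finset (Fin n), ConcaveOn ℝ Y (f t S))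
    (Lx Ly M DY : ℝ) (hLx : 0 < Lx) (hLy : 0 < Ly) (hM : 0 ≤ M) (hDY : 0 < DY)
    (hMbound : ∀ t, ∀ S : Finset (Fin n), ∀ y ∈ Y, |f t S y| ≤ M)
    (hdiam : ∀ y₁ ∈ Y, ∀ y₂ ∈ Y, enorm2 (fun j => y₁ j - y₂ j) ≤ DY)
    (ηx ηy : ℝ)
    (hηx : ηx = Real.sqrt n / (Lx * Real.sqrt T))
    (hηy : ηy = DY / (Ly * Real.sqrt T))
    (x : ℕ → Fin n → ℝ) (y : ℕ → Fin m → ℝ)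
    (gx : ℕ → Fin n → ℝ) (gy : ℕ → Fin m → ℝ)
    (hxmem : ∀ t, x t ∈ cube n) (hymem : ∀ t, y t ∈ Y)
    -- `gx t` is a subgradient of `f_L^t(·, y_t)` at `x_t` on the cube:
    (hgx : ∀ t, ∀ x' ∈ cube n,
      lovaszG (f t) (x t) (y t) + dot (gx t) (fun i => x' i - x t i)
        ≤ lovaszG (f t) x' (y t))
    -- `gy t` is a supergradient of `f_L^t(x_t, ·)` at `y_t` on `Y`:
    (hgy : ∀ t, ∀ y' ∈ Y,
      lovaszG (f t) (x t) y'
        ≤ lovaszG (f t) (x t) (y t) + dot (gy t) (fun j => y' j - y t j))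
    (hgxB : ∀ t, enorm2 (gx t) ≤ Lx) (hgyB : ∀ t, enorm2 (gy t) ≤ Ly)
    -- projected descent/ascent updates:
    (hxupd : ∀ t, IsProjOn (cube n) (fun i => x t i - ηx * gx t i) (x (t + 1)))
    (hyupd : ∀ t, IsProjOn Y (fun j => y t j + ηy * gy t j) (y (t + 1)))
    -- `(x⋆, y⋆)` is a saddle point of the averaged game:
    (xstar : Fin n → ℝ) (ystar : Fin m → ℝ)
    (hxstar : xstar ∈ cube n) (hystar : ystar ∈ Y)
    (hsaddle : ∀ x' ∈ cube n, ∀ y' ∈ Y,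
      (∑ t ∈ Finset.range T, lovaszG (f t) xstar y')
          ≤ (∑ t ∈ Finset.range T, lovaszG (f t) xstar ystar) ∧
      (∑ t ∈ Finset.range T, lovaszG (f t) xstar ystar)
          ≤ (∑ t ∈ Finset.range T, lovaszG (f t) x' ystar)) :
    (1 / T) * ∑ t ∈ Finset.range T,
        (lovaszG (f t) (x t) ystar - lovaszG (f t) xstar (y t))
      ≤ (Lx * Real.sqrt n + Ly * DY) / Real.sqrt T := by
  have hr : 0 < Real.sqrt T := Real.sqrt_pos.2 (by exact_mod_cast hT)
  have hrr : Real.sqrt T * Real.sqrt T = T := Real.mul_self_sqrt (Nat.cast_nonneg T)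
  have hX := sum_dot_le_of_isProjOn (convex_Icc _ _) hLx
    (Real.sqrt_pos.2 (by exact_mod_cast hn)) hT hηx hgxB hxupd hxstar
    (enorm2_sub_le_sqrt_of_mem_cube (hxmem 0) hxstar)
  have hYreg := sum_dot_le_of_isProjOn (g := fun t j => -gy t j) hYconv hLy hDY hT hηy
    (fun t => by simpa [enorm2, dot] using hgyB t) (fun t => by simpa using hyupd t) hystar
    (hdiam _ (hymem 0) _ hystar)
  have hstep : ∀ t ∈ Finset.range T,
      lovaszG (f t) (x t) ystar - lovaszG (f t) xstar (y t)
        ≤ dot (gx t) (fun i => x t i - xstar i)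
          + dot (fun j => -gy t j) (fun j => y t j - ystar j) := by
    intro t _
    have h₁ := hgx t xstar hxstar
    have h₂ := hgy t ystar hystar
    have h₃ : dot (gx t) (fun i => xstar i - x t i) = -dot (gx t) (fun i => x t i - xstar i) := by
      simp only [dot, ← Finset.sum_neg_distrib]
      exact Finset.sum_congr rfl fun i _ => by ring
    have h₄ : dot (fun j => -gy t j) (fun j => y t j - ystar j)
        = dot (gy t) (fun j => ystar j - y t j) :=
      Finset.sum_congr rfl fun i _ => by ring
    linarith
  have hsum := Finset.sum_le_sum hstep
  rw [Finset.sum_add_distrib] at hsum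
  rw [one_div_mul_eq_div, div_le_div_iff₀ (by positivity) hr]
  calc _ ≤ ((Lx * Real.sqrt n + Ly * DY) * Real.sqrt T) * Real.sqrt T :=
        mul_le_mul_of_nonneg_right (by linarith) hr.le
    _ = (Lx * Real.sqrt n + Ly * DY) * T := by rw [mul_assoc, hrr]

end
end
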